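/- Let G=(V,E,W) be a connected empirical graph with no self-loops, Γ = diag(1/(2d_i))_{i∈V}, Λ = diag(1/(2W_e))_{e∈E}, and suppose κ := ‖Γ^{1/2} Dᵀ Λ^{1/2}‖₂ ≤ 1. Let (x̂_SLP, ŷ_SLP) with x̂_SLP ∈ Q, ‖ŷ_SLP‖_∞ ≤ 1 be a saddle point of L, i.e. L(x̂_SLP, y) ≤ L(x̂_SLP, ŷ_SLP) ≤ L(x, ŷ_SLP) for all x ∈ Q and all y with ‖y‖_∞ ≤ 1. Let (x̂^{(k)}, ŷ^{(k)})_{k≥0} be generated by the SLP update rule from initializations x̂^{(−1)} = x̂^{(0)}, ŷ^{(0)}. Then for every K ≥ 1: ‖x̂_SLP − x̂^{(K)}‖²_{Γ⁻¹} ≤ ‖ŷ_SLP − ŷ^{(0)}‖²_{Λ⁻¹} + ‖x̂_SLP − x̂^{(0)}‖²_{Γ⁻¹}. -/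

import Mathlib

open Matrix Finset

noncomputable section

/-- The ℓ¹-norm of a finitely indexed real vector. -/
def l1Norm {ι : Type*} [Fintype ι] (u : ι → ℝ) : ℝ := ∑ i, |u i|

/-- The squared weighted norm `‖u‖²_Q = uᵀ Q u`. -/
def wnormSq {ι : Type*} [Fintype ι] (Q : Matrix ι ι ℝ) (u : ι → ℝ) : ℝ := u ⬝ᵥ (Q *ᵥ u)

/-- The closed ℓ∞ unit ball `{y : ‖y‖_∞ ≤ 1}`. -/
def linfBall (ι : Type*) : Set (ι → ℝ) := {y | ∀ e, |y e| ≤ 1}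

/-- `a` minimizes `f` over the set `S`. -/
def IsMinimizer {α : Type*} (S : Set α) (f : α → ℝ) (a : α) : Prop :=
  a ∈ S ∧ ∀ b ∈ S, f a ≤ f b

/-- Entrywise square root of the diagonal matrix with diagonal `g`. -/
def diagSqrt {ι : Type*} [Fintype ι] [DecidableEq ι] (g : ι → ℝ) : Matrix ι ι ℝ :=
  Matrix.diagonal (fun i => Real.sqrt (g i))

/-- The spectral norm `‖A‖₂ = sup_{‖u‖₂ = 1} ‖A u‖₂` of a real matrix. -/
def specNorm {m n : Type*} [Fintype m] [Fintype n] [DecidableEq n] (A : Matrix m n ℝ) : ℝ :=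
  ‖LinearMap.toContinuousLinearMap (Matrix.toEuclideanLin A)‖

/-- Objective of the dual resolvent step: `z ↦ ½ (ŷ + Λ D x̄ − z)ᵀ Λ⁻¹ (ŷ + Λ D x̄ − z)`. -/
def slpDualObj {V E : Type*} [Fintype V] [Fintype E] [DecidableEq E]
    (D : Matrix E V ℝ) (Λ : Matrix E E ℝ) (yk : E → ℝ) (xbar : V → ℝ) (z : E → ℝ) : ℝ :=
  (1/2) * wnormSq Λ⁻¹ (yk + Λ *ᵥ (D *ᵥ xbar) - z)

/-- Objective of the primal resolvent step: `z ↦ ½ (x̂ − Γ Dᵀ v − z)ᵀ Γ⁻¹ (x̂ − Γ Dᵀ v − z)`. -/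
def slpPrimalObj {V E : Type*} [Fintype V] [Fintype E] [DecidableEq V]
    (D : Matrix E V ℝ) (Γ : Matrix V V ℝ) (xk : V → ℝ) (v : E → ℝ) (z : V → ℝ) : ℝ :=
  (1/2) * wnormSq Γ⁻¹ (xk - Γ *ᵥ (Dᵀ *ᵥ v) - z)

/-- The SLP update rule: starting from `xs 0` (with `x^{(-1)} = x^{(0)}`, encoded via truncated
subtraction `0 - 1 = 0`) and `ys 0`, the iterate `ys (k+1)` minimizes the dual resolvent
objective over the ℓ∞ unit ball and `xs (k+1)` minimizes the primal resolvent objective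
over the constraint set `Q`. -/
def SLPSequences {V E : Type*} [Fintype V] [Fintype E] [DecidableEq V] [DecidableEq E]
    (D : Matrix E V ℝ) (Γ : Matrix V V ℝ) (Λ : Matrix E E ℝ) (Q : Set (V → ℝ))
    (xs : ℕ → V → ℝ) (ys : ℕ → E → ℝ) : Prop :=
  ∀ k : ℕ,
    IsMinimizer (linfBall E) (slpDualObj D Λ (ys k) ((2:ℝ) • xs k - xs (k-1))) (ys (k+1)) ∧
    IsMinimizer Q (slpPrimalObj D Γ (xs k) (ys (k+1))) (xs (k+1))

/-- An empirical graph: an undirected weighted graph together with a fixed orientation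
assigning each edge `e` a head `e⁺` and a tail `e⁻`, with positive weights, no self-loops,
and distinct edges joining distinct node pairs. -/
structure EmpiricalGraph (V E : Type*) where
  head : E → V
  tail : E → V
  w : E → ℝ
  w_pos : ∀ e, 0 < w e
  no_self_loop : ∀ e, head e ≠ tail e
  edge_inj : Function.Injective (fun e => ({head e, tail e} : Set V))

/-- The simple graph underlying an empirical graph. -/
def EmpiricalGraph.toSimpleGraph {V E : Type*} (G : EmpiricalGraph V E) : SimpleGraph V :=
  SimpleGraph.fromRel (fun i j => ∃ e, G.head e = i ∧ G.tail e = j)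

/-- Weighted node degree `d_i = ∑_{j ∈ N(i)} W_{i,j}`. -/
def EmpiricalGraph.deg {V E : Type*} [Fintype E] [DecidableEq V]
    (G : EmpiricalGraph V E) (i : V) : ℝ :=
  ∑ e, ((if G.head e = i then G.w e else 0) + (if G.tail e = i then G.w e else 0))

/-- Weighted oriented incidence matrix `D ∈ ℝ^{E×V}`: `D_{e,e⁺} = W_e`, `D_{e,e⁻} = −W_e`. -/
def EmpiricalGraph.incidence {V E : Type*} [DecidableEq V]
    (G : EmpiricalGraph V E) : Matrix E V ℝ :=
  Matrix.of fun e i => if G.head e = i then G.w e else if G.tail e = i then -G.w e else 0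


section WeightedNorm

variable {ι : Type*} [Fintype ι] [DecidableEq ι]

/-- The bilinear form of a diagonal matrix. -/
def diagForm (q u v : ι → ℝ) : ℝ := ∑ i, q i * u i * v i

lemma wnormSq_diagonal (q u : ι → ℝ) : wnormSq (diagonal q) u = ∑ i, q i * u i ^ 2 := by
  simp only [wnormSq, dotProduct, mulVec_diagonal]
  exact Finset.sum_congr rfl fun i _ => by ring

lemma wnormSq_diagonal_nonneg {q : ι → ℝ} (hq : ∀ i, 0 ≤ q i) (u : ι → ℝ) :
    0 ≤ wnormSq (diagonal q) u := by
  rw [wnormSq_diagonal]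
  exact Finset.sum_nonneg fun i _ => mul_nonneg (hq i) (sq_nonneg _)

lemma wnormSq_diagonal_sub_smul (q u v : ι → ℝ) (t : ℝ) :
    wnormSq (diagonal q) (u - t • v) =
      wnormSq (diagonal q) u - 2 * t * diagForm q u v + t ^ 2 * wnormSq (diagonal q) v := by
  simp only [wnormSq_diagonal, diagForm, Finset.mul_sum, ← Finset.sum_sub_distrib,
    ← Finset.sum_add_distrib, Pi.sub_apply, Pi.smul_apply, smul_eq_mul]
  exact Finset.sum_congr rfl fun i _ => by ring

/-- Polarization identity for the three points `a`, `b`, `c`. -/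
lemma two_mul_diagForm_sub (q a b c : ι → ℝ) :
    2 * diagForm q (a - b) (c - b) =
      wnormSq (diagonal q) (b - a) + wnormSq (diagonal q) (c - b)
        - wnormSq (diagonal q) (c - a) := by
  simp only [wnormSq_diagonal, diagForm, Finset.mul_sum, ← Finset.sum_sub_distrib,
    ← Finset.sum_add_distrib, Pi.sub_apply]
  exact Finset.sum_congr rfl fun i _ => by ring

/-- The variational inequality characterizing a weighted projection onto a convex set. -/
lemma IsMinimizer.diagForm_nonpos {S : Set (ι → ℝ)} (hS : Convex ℝ S) {q : ι → ℝ}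
    (hq : ∀ i, 0 ≤ q i) {c a b : ι → ℝ}
    (ha : IsMinimizer S (fun z => (1 / 2) * wnormSq (diagonal q) (c - z)) a) (hb : b ∈ S) :
    diagForm q (c - a) (b - a) ≤ 0 := by
  by_contra! hpos
  set B := diagForm q (c - a) (b - a)
  set N := wnormSq (diagonal q) (b - a)
  have hN : 0 ≤ N := wnormSq_diagonal_nonneg hq _
  have hden : 0 < B + N := by linarith
  have ht : 0 < B / (B + N) := div_pos hpos hden
  have ht1 : B / (B + N) ≤ 1 := (div_le_one hden).2 (by linarith)
  have hmin := ha.2 _ (hS.add_smul_sub_mem ha.1 hb ⟨ht.le, ht1⟩)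
  simp only [← sub_sub, wnormSq_diagonal_sub_smul] at hmin
  have htN : B / (B + N) * (B + N) = B := div_mul_cancel₀ _ hden.ne'
  nlinarith [mul_pos ht hpos, mul_pos ht (mul_pos ht hpos)]

/-- The variational inequality for a projected gradient step `u - diag(1/q) g`. -/
lemma IsMinimizer.projected_step {S : Set (ι → ℝ)} (hS : Convex ℝ S) {q : ι → ℝ}
    (hq : ∀ i, 0 < q i) {u g a b : ι → ℝ}
    (ha : IsMinimizer S
      (fun z => (1 / 2) * wnormSq (diagonal q) (u - diagonal (fun i => 1 / q i) *ᵥ g - z)) a)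
    (hb : b ∈ S) :
    diagForm q (u - a) (b - a) ≤ g ⬝ᵥ (b - a) := by
  have h := ha.diagForm_nonpos hS (fun i => (hq i).le) hb
  have hsplit : diagForm q (u - diagonal (fun i => 1 / q i) *ᵥ g - a) (b - a) =
      diagForm q (u - a) (b - a) - g ⬝ᵥ (b - a) := by
    simp only [diagForm, dotProduct, ← Finset.sum_sub_distrib, Pi.sub_apply, mulVec_diagonal]
    refine Finset.sum_congr rfl fun i _ => ?_
    have := (hq i).ne'
    field_simp
    ring
  linarith

lemma inv_diagonal_one_div {q : ι → ℝ} (hq : ∀ i, 0 < q i) :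
    (diagonal (fun i => 1 / q i))⁻¹ = diagonal q := by
  refine inv_eq_left_inv ?_
  rw [diagonal_mul_diagonal, ← diagonal_one]
  congr 1
  ext i
  exact mul_one_div_cancel (hq i).ne'

end WeightedNorm

lemma convex_linfBall (ι : Type*) : Convex ℝ (linfBall ι) := by
  intro x hx y hy a b ha hb hab e
  have hx := abs_le.1 (hx e)
  have hy := abs_le.1 (hy e)
  simp only [Pi.add_apply, Pi.smul_apply, smul_eq_mul]
  rw [abs_le]
  constructor <;> nlinarith

lemma convex_setOf_eqOn {V : Type*} (M : Set V) (f : V → ℝ) :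
    Convex ℝ {x : V → ℝ | ∀ i ∈ M, x i = f i} := by
  intro x hx y hy a b _ _ hab i hi
  simp only [Pi.add_apply, Pi.smul_apply, smul_eq_mul, hx i hi, hy i hi, ← add_mul, hab, one_mul]

namespace EmpiricalGraph

variable {V E : Type*} [DecidableEq V] (G : EmpiricalGraph V E)

lemma deg_nonneg [Fintype E] (i : V) : 0 ≤ G.deg i :=
  Finset.sum_nonneg fun e _ => by
    have := (G.w_pos e).le
    split_ifs <;> linarith

lemma incidence_mulVec [Fintype V] (a : V → ℝ) (e : E) :
    (G.incidence *ᵥ a) e = G.w e * (a (G.head e) - a (G.tail e)) := by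
  have hterm : ∀ i, G.incidence e i * a i =
      (if G.head e = i then G.w e * a i else 0) - (if G.tail e = i then G.w e * a i else 0) := by
    intro i
    have := G.no_self_loop e
    simp only [incidence, of_apply]
    split_ifs with h₁ h₂
    · exact absurd (h₁.trans h₂.symm) this
    all_goals ring
  simp only [mulVec, dotProduct, hterm, Finset.sum_sub_distrib, Finset.sum_ite_eq,
    Finset.mem_univ, if_true]
  ring

lemma sum_deg_mul [Fintype V] [Fintype E] (f : V → ℝ) :
    ∑ i, G.deg i * f i = ∑ e, G.w e * (f (G.head e) + f (G.tail e)) := by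
  simp only [deg, Finset.sum_mul]
  rw [Finset.sum_comm]
  refine Finset.sum_congr rfl fun e _ => ?_
  simp only [add_mul, ite_mul, zero_mul, Finset.sum_add_distrib, Finset.sum_ite_eq,
    Finset.mem_univ, if_true]
  ring

/-- The coupling term is dominated by the step-size norms. -/
lemma two_mul_dotProduct_incidence_le [Fintype V] [Fintype E] [DecidableEq E]
    (a : V → ℝ) (b : E → ℝ) :
    2 * (b ⬝ᵥ (G.incidence *ᵥ a)) ≤
      wnormSq (diagonal fun e => 2 * G.w e) b + wnormSq (diagonal fun i => 2 * G.deg i) a := by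
  have hdeg : wnormSq (diagonal fun i => 2 * G.deg i) a =
      ∑ e, 2 * (G.w e * (a (G.head e) ^ 2 + a (G.tail e) ^ 2)) := by
    rw [← Finset.mul_sum, ← G.sum_deg_mul fun i => a i ^ 2, Finset.mul_sum, wnormSq_diagonal]
    exact Finset.sum_congr rfl fun i _ => by ring
  rw [hdeg, wnormSq_diagonal, dotProduct, Finset.mul_sum, ← Finset.sum_add_distrib]
  refine Finset.sum_le_sum fun e _ => ?_
  rw [G.incidence_mulVec]
  set s := a (G.head e)
  set t := a (G.tail e)
  have hsq : 0 ≤ G.w e * ((b e - (s - t)) ^ 2 + b e ^ 2 + (s + t) ^ 2) :=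
    mul_nonneg (G.w_pos e).le (by positivity)
  linarith

end EmpiricalGraph

/-- One step of the primal-dual iteration does not increase the Lyapunov function
`‖y⋆ - y‖² + ‖x⋆ - x‖² + ‖x - x⁻‖² - 2⟨y⋆ - y, D (x - x⁻)⟩`. -/
lemma primalDual_step_le {V E : Type*} [Fintype V] [Fintype E] [DecidableEq V] [DecidableEq E]
    (D : Matrix E V ℝ) (q : V → ℝ) (p : E → ℝ) (hq : ∀ i, 0 < q i) (hp : ∀ e, 0 < p e)
    (hD : ∀ a b, 2 * (b ⬝ᵥ (D *ᵥ a)) ≤ wnormSq (diagonal p) b + wnormSq (diagonal q) a)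
    {S : Set (V → ℝ)} {T : Set (E → ℝ)} (hS : Convex ℝ S) (hT : Convex ℝ T)
    {xopt x₀ x₁ x₂ : V → ℝ} {yopt y₁ y₂ : E → ℝ} (hx : xopt ∈ S) (hy : yopt ∈ T)
    (hsaddle₁ : ∀ y ∈ T, y ⬝ᵥ (D *ᵥ xopt) ≤ yopt ⬝ᵥ (D *ᵥ xopt))
    (hsaddle₂ : ∀ x ∈ S, yopt ⬝ᵥ (D *ᵥ xopt) ≤ yopt ⬝ᵥ (D *ᵥ x))
    (hdual : IsMinimizer T (fun z => (1 / 2) * wnormSq (diagonal p)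
      (y₁ + diagonal (fun e => 1 / p e) *ᵥ (D *ᵥ ((2 : ℝ) • x₁ - x₀)) - z)) y₂)
    (hprimal : IsMinimizer S (fun z => (1 / 2) * wnormSq (diagonal q)
      (x₁ - diagonal (fun i => 1 / q i) *ᵥ (Dᵀ *ᵥ y₂) - z)) x₂) :
    wnormSq (diagonal p) (yopt - y₂) + wnormSq (diagonal q) (xopt - x₂)
        + wnormSq (diagonal q) (x₂ - x₁) - 2 * ((yopt - y₂) ⬝ᵥ (D *ᵥ (x₂ - x₁))) ≤
      wnormSq (diagonal p) (yopt - y₁) + wnormSq (diagonal q) (xopt - x₁)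
        + wnormSq (diagonal q) (x₁ - x₀) - 2 * ((yopt - y₁) ⬝ᵥ (D *ᵥ (x₁ - x₀))) := by
  have hdual' : IsMinimizer T (fun z => (1 / 2) * wnormSq (diagonal p)
      (y₁ - diagonal (fun e => 1 / p e) *ᵥ (-(D *ᵥ ((2 : ℝ) • x₁ - x₀))) - z)) y₂ := by
    simpa only [mulVec_neg, sub_neg_eq_add] using hdual
  have hd := hdual'.projected_step hT hp hy
  have hpr := hprimal.projected_step hS hq hx
  have h₁ := hsaddle₁ y₂ hdual.1
  have h₂ := hsaddle₂ x₂ hprimal.1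
  have hc := hD (x₁ - x₀) (y₂ - y₁)
  have hpol_y := two_mul_diagForm_sub p y₁ y₂ yopt
  have hpol_x := two_mul_diagForm_sub q x₁ x₂ xopt
  rw [mulVec_transpose, ← dotProduct_mulVec] at hpr
  rw [neg_dotProduct, dotProduct_comm] at hd
  simp only [mulVec_sub, mulVec_smul, dotProduct_sub, sub_dotProduct, dotProduct_smul,
    smul_eq_mul] at *
  linarith

/-- for a connected empirical graph with `Γ = diag(1/(2dᵢ))`,
`Λ = diag(1/(2Wₑ))`, `κ = ‖Γ^{1/2} Dᵀ Λ^{1/2}‖₂ ≤ 1`, a saddle point `(x̂_SLP, ŷ_SLP)`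
of `L(x,y) = yᵀDx` over `Q × {‖y‖_∞ ≤ 1}`, and SLP iterates, the primal iterates remain
bounded: `‖x̂_SLP − x̂⁽ᴷ⁾‖²_{Γ⁻¹} ≤ ‖ŷ_SLP − ŷ⁽⁰⁾‖²_{Λ⁻¹} + ‖x̂_SLP − x̂⁽⁰⁾‖²_{Γ⁻¹}`. -/
theorem slp_iterates_bounded
    {V E : Type*} [Fintype V] [Fintype E] [DecidableEq V] [DecidableEq E]
    (G : EmpiricalGraph V E)
    (hconn : G.toSimpleGraph.Connected)
    (M : Set V) (xtil : V → ℝ)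
    (Q : Set (V → ℝ)) (hQ : Q = {x : V → ℝ | ∀ i ∈ M, x i = xtil i})
    (Γ : Matrix V V ℝ) (hΓ : Γ = Matrix.diagonal (fun i => 1 / (2 * G.deg i)))
    (Λ : Matrix E E ℝ) (hΛ : Λ = Matrix.diagonal (fun e => 1 / (2 * G.w e)))
    (D : Matrix E V ℝ) (hD : D = G.incidence)
    (κ : ℝ)
    (hκ : κ = specNorm (diagSqrt (fun i => 1 / (2 * G.deg i)) * Dᵀ *
            diagSqrt (fun e => 1 / (2 * G.w e))))
    (hκ1 : κ ≤ 1)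
    (xSLP : V → ℝ) (ySLP : E → ℝ)
    (hxQ : xSLP ∈ Q) (hyball : ySLP ∈ linfBall E)
    (hsaddle₁ : ∀ y ∈ linfBall E, y ⬝ᵥ (D *ᵥ xSLP) ≤ ySLP ⬝ᵥ (D *ᵥ xSLP))
    (hsaddle₂ : ∀ x ∈ Q, ySLP ⬝ᵥ (D *ᵥ xSLP) ≤ ySLP ⬝ᵥ (D *ᵥ x))
    (xs : ℕ → V → ℝ) (ys : ℕ → E → ℝ)
    (hseq : SLPSequences D Γ Λ Q xs ys) :
    ∀ K : ℕ, 1 ≤ K →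
      wnormSq Γ⁻¹ (xSLP - xs K) ≤
        wnormSq Λ⁻¹ (ySLP - ys 0) + wnormSq Γ⁻¹ (xSLP - xs 0) := by
  have hpw : ∀ e, 0 < 2 * G.w e := fun e => mul_pos two_pos (G.w_pos e)
  have hΛinv : Λ⁻¹ = diagonal fun e => 2 * G.w e := hΛ ▸ inv_diagonal_one_div hpw
  intro K _
  by_cases hdeg : ∀ i, 0 < G.deg i
  · have hqd : ∀ i, 0 < 2 * G.deg i := fun i => mul_pos two_pos (hdeg i)
    have hΓinv : Γ⁻¹ = diagonal fun i => 2 * G.deg i := hΓ ▸ inv_diagonal_one_div hqd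
    have hcoupling : ∀ a b, 2 * (b ⬝ᵥ (D *ᵥ a)) ≤
        wnormSq (diagonal fun e => 2 * G.w e) b + wnormSq (diagonal fun i => 2 * G.deg i) a :=
      hD ▸ G.two_mul_dotProduct_incidence_le
    have hconv : Convex ℝ Q := hQ ▸ convex_setOf_eqOn M xtil
    rw [hΓinv, hΛinv]
    have hLyapunov : ∀ k, wnormSq (diagonal fun e => 2 * G.w e) (ySLP - ys k)
          + wnormSq (diagonal fun i => 2 * G.deg i) (xSLP - xs k)
          + wnormSq (diagonal fun i => 2 * G.deg i) (xs k - xs (k - 1))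
          - 2 * ((ySLP - ys k) ⬝ᵥ (D *ᵥ (xs k - xs (k - 1)))) ≤
        wnormSq (diagonal fun e => 2 * G.w e) (ySLP - ys 0)
          + wnormSq (diagonal fun i => 2 * G.deg i) (xSLP - xs 0) := by
      intro k
      induction k with
      | zero => simp [wnormSq]
      | succ k ih =>
        obtain ⟨hdual, hprimal⟩ := hseq k
        unfold slpDualObj at hdual
        unfold slpPrimalObj at hprimal
        rw [hΛinv, hΛ] at hdual
        rw [hΓinv, hΓ] at hprimal
        exact (primalDual_step_le D _ _ hqd hpw hcoupling hconv (convex_linfBall E) hxQ hyball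
          hsaddle₁ hsaddle₂ hdual hprimal).trans ih
    linarith [hLyapunov K, hcoupling (xs K - xs (K - 1)) (ySLP - ys K)]
  · push Not at hdeg
    obtain ⟨i, hi⟩ := hdeg
    have hi0 : G.deg i = 0 := le_antisymm hi (G.deg_nonneg i)
    have hdet : Γ.det = 0 := by
      rw [hΓ, det_diagonal]
      exact Finset.prod_eq_zero (Finset.mem_univ i) (by simp [hi0])
    have hΓinv : Γ⁻¹ = 0 := nonsing_inv_apply_not_isUnit _ (by simp [hdet])
    rw [hΓinv, hΛinv]
    simpa [wnormSq] using wnormSq_diagonal_nonneg (fun e => (hpw e).le) (ySLP - ys 0)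

end
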